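/- Let σ: S ↷ G be a non-automorphic algebraic action. The map 𝔛 ↦ 𝔉(𝔛) := {𝔉(χ) : χ ∈ 𝔛} is a one-to-one correspondence between the closed I-invariant subsets of ∂Ê and the I^e-invariant, ⊆-closed subsets of 𝔽_𝒞; its inverse sends 𝔽 ⊆ 𝔽_𝒞 to 𝔉⁻¹(𝔽) := {χ ∈ ∂Ê : 𝔉(χ) ∈ 𝔽}. -/

import Mathlib

open scoped Pointwise

/-- The family of `S`-constructible subgroups of `G`. -/
inductive IsConstructible {S G : Type*} [Monoid S] [Group G]
    (σ : S →* Monoid.End G) : Subgroup G → Prop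
  | top : IsConstructible σ ⊤
  | map : ∀ (s : S) (C : Subgroup G), IsConstructible σ C →
      IsConstructible σ (Subgroup.map (σ s) C)
  | comap : ∀ (s : S) (C : Subgroup G), IsConstructible σ C →
      IsConstructible σ (Subgroup.comap (σ s) C)

/- We model partial bijections of `G` by their graphs, i.e. subsets of `G × G`
that are graphs of injective partial functions; equality of graphs is exactly
equality of partial bijections. -/

/-- Graph of an everywhere-defined function. -/
def grph {G : Type*} (f : G → G) : Set (G × G) := {p | p.2 = f p.1}

/-- Composition `φ ∘ ψ` of partial bijections (apply `ψ` first), as graphs. -/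
def rcomp {G : Type*} (φ ψ : Set (G × G)) : Set (G × G) :=
  {p | ∃ y, (p.1, y) ∈ ψ ∧ (y, p.2) ∈ φ}

/-- Inverse of a partial bijection, as graphs. -/
def rinv {G : Type*} (φ : Set (G × G)) : Set (G × G) := {p | (p.2, p.1) ∈ φ}

/-- Domain of a partial bijection. -/
def rdom {G : Type*} (φ : Set (G × G)) : Set G := {x | ∃ y, (x, y) ∈ φ}

/-- The identity map on a subset `A ⊆ G`, as a graph. -/
def idOn {G : Type*} (A : Set G) : Set (G × G) := {p | p.1 = p.2 ∧ p.1 ∈ A}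

/-- Membership in the inverse semigroup of partial bijections generated by a
set of generators: closure under composition and inversion. -/
inductive MemInvSemigroup {G : Type*} (gens : Set (Set (G × G))) : Set (G × G) → Prop
  | base : ∀ φ ∈ gens, MemInvSemigroup gens φ
  | comp : ∀ φ ψ, MemInvSemigroup gens φ → MemInvSemigroup gens ψ →
      MemInvSemigroup gens (rcomp φ ψ)
  | inv : ∀ φ, MemInvSemigroup gens φ → MemInvSemigroup gens (rinv φ)

/-- The inverse semigroup `I` generated by the endomorphisms `σ_s` and the left
translations `t_g`. -/
def memI {S G : Type*} [Monoid S] [Group G] (σ : S →* Monoid.End G) :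
    Set (G × G) → Prop :=
  MemInvSemigroup ({φ | ∃ s : S, φ = grph (σ s : G → G)} ∪
    {φ | ∃ g : G, φ = grph (fun h : G => g * h)})


/-- The inverse semigroup `I^e` generated by the endomorphisms `σ_s` alone. -/
def memIe {S G : Type*} [Monoid S] [Group G] (σ : S →* Monoid.End G) :
    Set (G × G) → Prop :=
  MemInvSemigroup {φ | ∃ s : S, φ = grph (σ s : G → G)}
def ECoset {S G : Type*} [Monoid S] [Group G] (σ : S →* Monoid.End G) : Set (Set G) :=
  {E | E = ∅ ∨ ∃ (g : G) (C : Subgroup G), IsConstructible σ C ∧ E = g • (C : Set G)}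

/-- A character of `ℰ`: multiplicative, sends `∅` to `0` and `G` to `1`.
(We represent characters as Boolean functions on `Set G`, pinned to `false`
outside `ℰ`, so that equality of characters is equality of functions and the
topology of pointwise convergence is the product topology.) -/
def IsChar {S G : Type*} [Monoid S] [Group G] (σ : S →* Monoid.End G)
    (χ : Set G → Bool) : Prop :=
  χ ∅ = false ∧ χ Set.univ = true ∧
  (∀ E F : Set G, E ∈ ECoset σ → F ∈ ECoset σ → χ (E ∩ F) = (χ E && χ F)) ∧
  (∀ E : Set G, E ∉ ECoset σ → χ E = false)

/-- The filter of a character: the collection of elements of `ℰ` on which it is `1`. -/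
def charFilter {G : Type*} (χ : Set G → Bool) : Set (Set G) := {E | χ E = true}

/-- A character is maximal if its filter is maximal with respect to inclusion. -/
def IsMaxChar {S G : Type*} [Monoid S] [Group G] (σ : S →* Monoid.End G)
    (χ : Set G → Bool) : Prop :=
  IsChar σ χ ∧ ∀ ω : Set G → Bool, IsChar σ ω → charFilter χ ⊆ charFilter ω →
    charFilter ω = charFilter χ

/-- The boundary `∂Ê`: the closure of the set of maximal characters, inside the
character space `Ê`. -/
def Boundary {S G : Type*} [Monoid S] [Group G] (σ : S →* Monoid.End G) :
    Set (Set G → Bool) :=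
  {χ | IsChar σ χ} ∩ closure {χ : Set G → Bool | IsMaxChar σ χ}

/-- `𝔉(χ)`: the filter on `𝒞` induced by a character `χ`, consisting of those
constructible subgroups `C` with `χ(gC) = 1` for some `g`. -/
def FilC {S G : Type*} [Monoid S] [Group G] (σ : S →* Monoid.End G)
    (χ : Set G → Bool) : Set (Subgroup G) :=
  {C | IsConstructible σ C ∧ ∃ g : G, χ (g • (C : Set G)) = true}

/-- Image of a set under a partial bijection (given as a graph). -/
def rimg {G : Type*} (φ : Set (G × G)) (E : Set G) : Set G := {y | ∃ x ∈ E, (x, y) ∈ φ}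

/-- Preimage of a set under a partial bijection: `φ⁻¹(E ∩ im φ)`. -/
def preimRel {G : Type*} (φ : Set (G × G)) (E : Set G) : Set G :=
  {x | ∃ y ∈ E, (x, y) ∈ φ}

open Classical in
/-- The action of `φ ∈ I` on characters: `(φ.χ)(E) = χ(φ⁻¹(E ∩ im φ))` for
`E ∈ ℰ` (and `false` off `ℰ`, matching our representation of characters). -/
noncomputable def charAct {S G : Type*} [Monoid S] [Group G] (σ : S →* Monoid.End G)
    (φ : Set (G × G)) (χ : Set G → Bool) : Set G → Bool :=
  fun E => if E ∈ ECoset σ then χ (preimRel φ E) else false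

/-- A subset `𝔛 ⊆ ∂Ê` is `I`-invariant if `φ.χ ∈ 𝔛` whenever `φ ∈ I`, `χ ∈ 𝔛`
and `χ(dom φ) = 1`. -/
def IsInvariantSet {S G : Type*} [Monoid S] [Group G] (σ : S →* Monoid.End G)
    (𝔛 : Set (Set G → Bool)) : Prop :=
  ∀ φ : Set (G × G), memI σ φ → ∀ χ ∈ 𝔛, χ (rdom φ) = true → charAct σ φ χ ∈ 𝔛

/-- A finitely hereditary filter on the semilattice `𝒞` of constructible
subgroups: contains `G = ⊤`, closed under intersections, upward closed in `𝒞`,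
and containing with each member all its finite-index constructible subgroups. -/
def FinHerFilter {S G : Type*} [Monoid S] [Group G] (σ : S →* Monoid.End G)
    (𝔉 : Set (Subgroup G)) : Prop :=
  (∀ C ∈ 𝔉, IsConstructible σ C) ∧ (⊤ : Subgroup G) ∈ 𝔉 ∧
  (∀ C ∈ 𝔉, ∀ D ∈ 𝔉, C ⊓ D ∈ 𝔉) ∧
  (∀ C ∈ 𝔉, ∀ D : Subgroup G, IsConstructible σ D → C ≤ D → D ∈ 𝔉) ∧
  (∀ C ∈ 𝔉, ∀ D : Subgroup G, IsConstructible σ D → D ≤ C → D.relIndex C ≠ 0 → D ∈ 𝔉)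

/-- The generating set for the action of `φ ∈ I^e` on a filter `𝔉`:
the images `φ(D)` for `D ∈ 𝔉` contained in `dom φ`. -/
def filterActGens {S G : Type*} [Monoid S] [Group G] (σ : S →* Monoid.End G)
    (φ : Set (G × G)) (𝔉 : Set (Subgroup G)) : Set (Subgroup G) :=
  {B | ∃ D ∈ 𝔉, (D : Set G) ⊆ rdom φ ∧ (B : Set G) = rimg φ (D : Set G)}

/-- `𝔊` is the smallest finitely hereditary filter containing a given family. -/
def IsSmallestFHF {S G : Type*} [Monoid S] [Group G] (σ : S →* Monoid.End G)
    (A : Set (Subgroup G)) (𝔊 : Set (Subgroup G)) : Prop :=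
  FinHerFilter σ 𝔊 ∧ A ⊆ 𝔊 ∧
    ∀ 𝔊' : Set (Subgroup G), FinHerFilter σ 𝔊' → A ⊆ 𝔊' → 𝔊 ⊆ 𝔊'

/-- A set `𝔽` of finitely hereditary filters is `I^e`-invariant if it is closed
under the partial action of `I^e`: whenever `φ.𝔉` is defined (i.e. some
`C ∈ 𝔉` satisfies `C ⊆ dom φ`), the resulting filter `φ.𝔉` belongs to `𝔽`. -/
def IeInvariant {S G : Type*} [Monoid S] [Group G] (σ : S →* Monoid.End G)
    (𝔽 : Set (Set (Subgroup G))) : Prop :=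
  ∀ 𝔉 ∈ 𝔽, ∀ φ : Set (G × G), memIe σ φ →
    (∃ C ∈ 𝔉, (C : Set G) ⊆ rdom φ) →
    ∀ 𝔊 : Set (Subgroup G), IsSmallestFHF σ (filterActGens σ φ 𝔉) 𝔊 → 𝔊 ∈ 𝔽

/-- A set `𝔽` of finitely hereditary filters is `⊆`-closed if every finitely
hereditary filter contained in `⋃_{𝔉 ∈ 𝔽} 𝔉` belongs to `𝔽`. -/
def SubsetClosed {S G : Type*} [Monoid S] [Group G] (σ : S →* Monoid.End G)
    (𝔽 : Set (Set (Subgroup G))) : Prop :=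
  ∀ 𝔈 : Set (Subgroup G), FinHerFilter σ 𝔈 →
    (∀ C ∈ 𝔈, ∃ 𝔉 ∈ 𝔽, C ∈ 𝔉) → 𝔈 ∈ 𝔽

section Relations

variable {G : Type*}

theorem rinv_rcomp (φ ψ : Set (G × G)) : rinv (rcomp φ ψ) = rcomp (rinv ψ) (rinv φ) := by
  ext ⟨x, y⟩
  exact ⟨fun ⟨z, h, h'⟩ => ⟨z, h', h⟩, fun ⟨z, h, h'⟩ => ⟨z, h', h⟩⟩

theorem preimRel_rcomp (φ ψ : Set (G × G)) (E : Set G) :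
    preimRel (rcomp φ ψ) E = preimRel ψ (preimRel φ E) := by
  ext x
  exact ⟨fun ⟨y, hy, z, h, h'⟩ => ⟨z, ⟨y, hy, h'⟩, h⟩, fun ⟨z, ⟨y, hy, h'⟩, h⟩ => ⟨y, hy, z, h, h'⟩⟩

theorem preimRel_univ (φ : Set (G × G)) : preimRel φ Set.univ = rdom φ := by
  ext x
  simp [preimRel, rdom]

theorem preimRel_mono (φ : Set (G × G)) {E F : Set G} (h : E ⊆ F) :
    preimRel φ E ⊆ preimRel φ F := fun _ ⟨y, hy, hxy⟩ => ⟨y, h hy, hxy⟩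

theorem preimRel_grph (f : G → G) (E : Set G) : preimRel (grph f) E = f ⁻¹' E := by
  ext x
  simp [preimRel, grph]

theorem preimRel_rinv_grph (f : G → G) (E : Set G) : preimRel (rinv (grph f)) E = f '' E := by
  ext x
  simp [preimRel, grph, rinv, eq_comm]

/-- Induction for inverse semigroups: a property closed under composition which holds for
generators and their inverses holds for every element and its inverse. -/
theorem MemInvSemigroup.induction_inv {gens : Set (Set (G × G))} {P : Set (G × G) → Prop}
    (hgen : ∀ φ ∈ gens, P φ ∧ P (rinv φ))
    (hcomp : ∀ φ ψ, MemInvSemigroup gens φ → MemInvSemigroup gens ψ → P φ → P ψ → P (rcomp φ ψ))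
    {φ : Set (G × G)} (hφ : MemInvSemigroup gens φ) : P φ ∧ P (rinv φ) := by
  induction hφ with
  | base φ h => exact hgen φ h
  | comp φ ψ hφ hψ ih ih' =>
    refine ⟨hcomp _ _ hφ hψ ih.1 ih'.1, ?_⟩
    rw [rinv_rcomp]
    exact hcomp _ _ (.inv _ hψ) (.inv _ hφ) ih'.2 ih.2
  | inv φ _ ih => exact ⟨ih.2, ih.1⟩

theorem mem_closure_iff_finset {A : Set (Set G → Bool)} {χ : Set G → Bool} :
    χ ∈ closure A ↔ ∀ J : Finset (Set G), ∃ ω ∈ A, ∀ E ∈ J, ω E = χ E := by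
  rw [mem_closure_iff]
  constructor
  · intro h J
    obtain ⟨ω, hω, hA⟩ := h ((J : Set (Set G)).pi fun E => {χ E})
      (isOpen_set_pi J.finite_toSet fun _ _ => isOpen_discrete _) fun E _ => rfl
    exact ⟨ω, hA, fun E hE => hω E hE⟩
  · intro h U hU hχ
    obtain ⟨J, u, hu, hJ⟩ := isOpen_pi_iff.1 hU χ hχ
    obtain ⟨ω, hω, hE⟩ := h J
    exact ⟨ω, hJ fun E hEJ => by rw [hE E hEJ]; exact (hu E hEJ).2, hω⟩

end Relations

section Helpers

variable {S G : Type*} [Monoid S] [Group G] {σ : S →* Monoid.End G}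

/-! ### Constructible subgroups and cosets -/

theorem IsConstructible.inf (hinj : ∀ s : S, Function.Injective (σ s)) {C D : Subgroup G}
    (hC : IsConstructible σ C) (hD : IsConstructible σ D) : IsConstructible σ (C ⊓ D) := by
  induction hC generalizing D with
  | top => simpa using hD
  | map s C _ ih =>
    have h : Subgroup.map (σ s) C ⊓ D = Subgroup.map (σ s) (C ⊓ Subgroup.comap (σ s) D) := by
      ext x
      simp only [Subgroup.mem_inf]
      constructor
      · rintro ⟨⟨y, hy, rfl⟩, hx⟩
        exact ⟨y, ⟨hy, hx⟩, rfl⟩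
      · rintro ⟨y, ⟨hy, hx⟩, rfl⟩
        exact ⟨⟨y, hy, rfl⟩, hx⟩
    rw [h]
    exact .map s _ (ih (.comap s _ hD))
  | comap s C _ ih =>
    have h : Subgroup.comap (σ s) C ⊓ D = Subgroup.comap (σ s) (C ⊓ Subgroup.map (σ s) D) := by
      ext x
      simp only [Subgroup.mem_inf]
      constructor
      · rintro ⟨hx, hD⟩
        exact ⟨hx, x, hD, rfl⟩
      · rintro ⟨hx, y, hy, hxy⟩
        exact ⟨hx, hinj s hxy ▸ hy⟩
    rw [h]
    exact .comap s _ (ih (.map s _ hD))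

theorem smul_coe_eq_of_mem {C : Subgroup G} {g x : G} (hx : x ∈ g • (C : Set G)) :
    g • (C : Set G) = x • (C : Set G) :=
  (leftCoset_eq_iff C).2 ((mem_leftCoset_iff g).1 hx)

theorem mem_smul_coe_self (C : Subgroup G) (g : G) : g ∈ g • (C : Set G) :=
  (mem_leftCoset_iff g).2 (by simp)

theorem smul_coe_mem_ECoset {C : Subgroup G} (hC : IsConstructible σ C) (g : G) :
    g • (C : Set G) ∈ ECoset σ := Or.inr ⟨g, C, hC, rfl⟩

theorem coe_mem_ECoset {C : Subgroup G} (hC : IsConstructible σ C) : (C : Set G) ∈ ECoset σ :=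
  Or.inr ⟨1, C, hC, by simp⟩

theorem empty_mem_ECoset : (∅ : Set G) ∈ ECoset σ := Or.inl rfl

theorem univ_mem_ECoset : (Set.univ : Set G) ∈ ECoset σ := by
  simpa using coe_mem_ECoset (σ := σ) .top

theorem eq_smul_of_mem_ECoset {E : Set G} (hE : E ∈ ECoset σ) {x : G} (hx : x ∈ E) :
    ∃ C : Subgroup G, IsConstructible σ C ∧ E = x • (C : Set G) := by
  rcases hE with rfl | ⟨g, C, hC, rfl⟩
  · simp at hx
  · exact ⟨C, hC, smul_coe_eq_of_mem hx⟩

theorem inter_mem_ECoset (hinj : ∀ s : S, Function.Injective (σ s)) {E F : Set G}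
    (hE : E ∈ ECoset σ) (hF : F ∈ ECoset σ) : E ∩ F ∈ ECoset σ := by
  rcases (E ∩ F).eq_empty_or_nonempty with h | ⟨x, hxE, hxF⟩
  · exact h ▸ empty_mem_ECoset
  · obtain ⟨C, hC, rfl⟩ := eq_smul_of_mem_ECoset hE hxE
    obtain ⟨D, hD, rfl⟩ := eq_smul_of_mem_ECoset hF hxF
    exact Or.inr ⟨x, C ⊓ D, hC.inf hinj hD, by rw [Subgroup.coe_inf, Set.smul_set_inter]⟩

theorem smul_mem_ECoset {E : Set G} (hE : E ∈ ECoset σ) (t : G) : t • E ∈ ECoset σ := by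
  rcases hE with rfl | ⟨g, C, hC, rfl⟩
  · simpa using empty_mem_ECoset
  · rw [smul_smul]
    exact smul_coe_mem_ECoset hC _

theorem smul_mem_ECoset_iff {E : Set G} {t : G} : t • E ∈ ECoset σ ↔ E ∈ ECoset σ :=
  ⟨fun h => by simpa using smul_mem_ECoset h t⁻¹, fun h => smul_mem_ECoset h t⟩

/-! ### Elements of the inverse semigroups -/

theorem preimRel_grph_mul (t : G) (E : Set G) :
    preimRel (grph (fun h : G => t * h)) E = t⁻¹ • E := by
  ext x
  simp [preimRel_grph, Set.mem_smul_set_iff_inv_smul_mem]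

theorem rinv_grph_mul (t : G) :
    rinv (grph (fun h : G => t * h)) = grph (fun h : G => t⁻¹ * h) := by
  ext ⟨x, y⟩
  simp [rinv, grph, eq_inv_mul_iff_mul_eq, eq_comm]

theorem memI_of_memIe {φ : Set (G × G)} (hφ : memIe σ φ) : memI σ φ := by
  induction hφ with
  | base φ h => exact .base _ (Or.inl h)
  | comp φ ψ _ _ ih ih' => exact .comp _ _ ih ih'
  | inv φ _ ih => exact .inv _ ih

theorem memI_mul (t : G) : memI σ (grph (fun h : G => t * h)) := .base _ (Or.inr ⟨t, rfl⟩)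

theorem memI_functional (hinj : ∀ s : S, Function.Injective (σ s)) {φ : Set (G × G)}
    (hφ : memI σ φ) {x y z : G} (hy : (x, y) ∈ φ) (hz : (x, z) ∈ φ) : y = z := by
  refine (MemInvSemigroup.induction_inv
    (P := fun φ => ∀ x y z : G, (x, y) ∈ φ → (x, z) ∈ φ → y = z) ?_ ?_ hφ).1 x y z hy hz
  · rintro φ (⟨s, rfl⟩ | ⟨g, rfl⟩)
    · exact ⟨fun x y z hy hz => hy.trans hz.symm, fun x y z hy hz => hinj s (hy.symm.trans hz)⟩
    · exact ⟨fun x y z hy hz => hy.trans hz.symm,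
        fun x y z hy hz => mul_left_cancel (hy.symm.trans hz)⟩
  · rintro φ ψ - - h h' x y z ⟨a, ha, hay⟩ ⟨b, hb, hbz⟩
    obtain rfl := h' _ _ _ ha hb
    exact h _ _ _ hay hbz

theorem preimRel_inter (hinj : ∀ s : S, Function.Injective (σ s)) {φ : Set (G × G)}
    (hφ : memI σ φ) (E F : Set G) : preimRel φ (E ∩ F) = preimRel φ E ∩ preimRel φ F := by
  ext x
  constructor
  · rintro ⟨y, ⟨hE, hF⟩, h⟩
    exact ⟨⟨y, hE, h⟩, y, hF, h⟩
  · rintro ⟨⟨y, hE, h⟩, z, hF, h'⟩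
    obtain rfl := memI_functional hinj hφ h h'
    exact ⟨y, ⟨hE, hF⟩, h⟩

theorem preimRel_mem_ECoset {φ : Set (G × G)}
    (hφ : memI σ φ) {E : Set G} (hE : E ∈ ECoset σ) : preimRel φ E ∈ ECoset σ := by
  refine (MemInvSemigroup.induction_inv
    (P := fun φ => ∀ E ∈ ECoset σ, preimRel φ E ∈ ECoset σ) ?_ ?_ hφ).1 E hE
  · rintro φ (⟨s, rfl⟩ | ⟨g, rfl⟩)
    · constructor
      · intro E hE
        rw [preimRel_grph]
        rcases ((σ s : G → G) ⁻¹' E).eq_empty_or_nonempty with h | ⟨x, hx⟩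
        · exact h ▸ empty_mem_ECoset
        · obtain ⟨C, hC, rfl⟩ := eq_smul_of_mem_ECoset hE hx
          refine Or.inr ⟨x, _, .comap s C hC, ?_⟩
          ext y
          have h : y ∈ x • (Subgroup.comap (σ s) C : Set G) ↔ σ s (x⁻¹ * y) ∈ C :=
            mem_leftCoset_iff x
          rw [h, Set.mem_preimage, mem_leftCoset_iff, map_mul, map_inv, SetLike.mem_coe]
      · intro E hE
        rw [preimRel_rinv_grph]
        rcases hE with rfl | ⟨g, C, hC, rfl⟩
        · simpa using empty_mem_ECoset
        · exact Or.inr ⟨σ s g, _, .map s C hC, Set.image_smul_distrib (σ s) g _⟩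
    · rw [rinv_grph_mul]
      simp only [preimRel_grph_mul]
      exact ⟨fun E hE => smul_mem_ECoset hE _, fun E hE => smul_mem_ECoset hE _⟩
  · intro φ ψ _ _ h h' E hE
    rw [preimRel_rcomp]
    exact h' _ (h _ hE)

theorem rdom_mem_ECoset {φ : Set (G × G)} (hφ : memI σ φ) : rdom φ ∈ ECoset σ :=
  preimRel_univ φ ▸ preimRel_mem_ECoset hφ univ_mem_ECoset

theorem exists_subgroup_of_memIe {φ : Set (G × G)} (hφ : memIe σ φ) :
    ∃ Φ : Subgroup (G × G), (Φ : Set (G × G)) = φ := by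
  refine (MemInvSemigroup.induction_inv
    (P := fun φ => ∃ Φ : Subgroup (G × G), (Φ : Set (G × G)) = φ) ?_ ?_ hφ).1
  · rintro φ ⟨s, rfl⟩
    have h : ((MonoidHom.graph (σ s : G →* G) : Subgroup (G × G)) : Set (G × G)) = grph (σ s) := by
      ext ⟨x, y⟩
      exact eq_comm
    refine ⟨⟨_, h⟩, (MonoidHom.graph (σ s : G →* G)).comap (MulEquiv.prodComm : G × G ≃* G × G), ?_⟩
    rw [← h]
    rfl
  · rintro φ ψ - - ⟨Φ, rfl⟩ ⟨Ψ, rfl⟩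
    refine ⟨⟨⟨⟨rcomp Φ Ψ, ?_⟩, ?_⟩, ?_⟩, rfl⟩
    · rintro ⟨a, b⟩ ⟨c, d⟩ ⟨x, h, h'⟩ ⟨y, k, k'⟩
      exact ⟨x * y, Ψ.mul_mem h k, Φ.mul_mem h' k'⟩
    · exact ⟨1, Ψ.one_mem, Φ.one_mem⟩
    · rintro ⟨a, b⟩ ⟨x, h, k⟩
      exact ⟨x⁻¹, Ψ.inv_mem h, Φ.inv_mem k⟩

/-- The preimage of a constructible subgroup under a partial bijection in `I^e`. -/
theorem exists_preimRel_eq {φ : Set (G × G)} (hφ : memIe σ φ) {C : Subgroup G}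
    (hC : IsConstructible σ C) :
    ∃ D : Subgroup G, IsConstructible σ D ∧ (D : Set G) = preimRel φ C := by
  obtain ⟨Φ, rfl⟩ := exists_subgroup_of_memIe hφ
  obtain ⟨D, hD, h⟩ := eq_smul_of_mem_ECoset
    (preimRel_mem_ECoset (memI_of_memIe hφ) (coe_mem_ECoset hC))
    (x := 1) ⟨1, C.one_mem, Φ.one_mem⟩
  exact ⟨D, hD, by simp [h]⟩

theorem preimRel_smul {φ : Set (G × G)} (hφ : memIe σ φ) {x y : G} (hxy : (x, y) ∈ φ)
    (C : Subgroup G) : preimRel φ (y • (C : Set G)) = x • preimRel φ C := by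
  obtain ⟨Φ, rfl⟩ := exists_subgroup_of_memIe hφ
  ext z
  simp only [Set.mem_smul_set_iff_inv_smul_mem, smul_eq_mul]
  constructor
  · rintro ⟨w, hw, h⟩
    exact ⟨y⁻¹ * w, (mem_leftCoset_iff y).1 hw, Φ.mul_mem (Φ.inv_mem hxy) h⟩
  · rintro ⟨w, hw, h⟩
    refine ⟨y * w, (mem_leftCoset_iff y).2 (by simpa using hw), ?_⟩
    simpa using Φ.mul_mem hxy h

/-! ### Characters -/

namespace IsChar

variable {χ : Set G → Bool}

theorem mem_ECoset (hχ : IsChar σ χ) {E : Set G} (hE : χ E = true) : E ∈ ECoset σ := by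
  by_contra h
  simp [hχ.2.2.2 E h] at hE

theorem inter (hχ : IsChar σ χ) {E F : Set G} (hE : χ E = true) (hF : χ F = true) :
    χ (E ∩ F) = true := by
  rw [hχ.2.2.1 E F (hχ.mem_ECoset hE) (hχ.mem_ECoset hF), hE, hF, Bool.and_self]

theorem nonempty (hχ : IsChar σ χ) {E : Set G} (hE : χ E = true) : E.Nonempty := by
  rw [Set.nonempty_iff_ne_empty]
  rintro rfl
  simp [hχ.1] at hE

theorem mono (hχ : IsChar σ χ) {E F : Set G} (hE : χ E = true) (hF : F ∈ ECoset σ)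
    (h : E ⊆ F) : χ F = true := by
  have h' := hχ.2.2.1 E F (hχ.mem_ECoset hE) hF
  rw [Set.inter_eq_left.2 h, hE] at h'
  simpa using h'

theorem exists_eq_smul (hχ : IsChar σ χ) {E : Set G} (hE : χ E = true) :
    ∃ (g : G) (C : Subgroup G), IsConstructible σ C ∧ E = g • (C : Set G) := by
  obtain ⟨x, hx⟩ := hχ.nonempty hE
  exact ⟨x, eq_smul_of_mem_ECoset (hχ.mem_ECoset hE) hx⟩

theorem exists_subset_finset (hχ : IsChar σ χ) (J : Finset (Set G)) (f : Set G → Set G)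
    (hf : ∀ E ∈ J, χ (f E) = true) : ∃ E₀, χ E₀ = true ∧ ∀ E ∈ J, E₀ ⊆ f E := by
  classical
  induction J using Finset.induction_on with
  | empty => exact ⟨Set.univ, hχ.2.1, by simp⟩
  | insert E J _ ih =>
    obtain ⟨E₀, h, h'⟩ := ih fun E hE => hf E (Finset.mem_insert_of_mem hE)
    refine ⟨f E ∩ E₀, hχ.inter (hf E (Finset.mem_insert_self E J)) h, fun F hF => ?_⟩
    rcases Finset.mem_insert.1 hF with rfl | hF
    · exact Set.inter_subset_left
    · exact Set.inter_subset_right.trans (h' F hF)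

end IsChar

open Classical in
/-- The character of `ℰ` given by evaluation at a point of `G`. -/
noncomputable def pointChar (σ : S →* Monoid.End G) (x : G) : Set G → Bool :=
  fun E => decide (E ∈ ECoset σ ∧ x ∈ E)

theorem pointChar_eq_true {x : G} {E : Set G} :
    pointChar σ x E = true ↔ E ∈ ECoset σ ∧ x ∈ E := by simp [pointChar]

theorem isChar_pointChar (hinj : ∀ s : S, Function.Injective (σ s)) (x : G) :
    IsChar σ (pointChar σ x) := by
  refine ⟨by simp [pointChar], by simp [pointChar, univ_mem_ECoset], fun E F hE hF => ?_,
    fun E hE => by simp [pointChar, hE]⟩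
  rw [Bool.eq_iff_iff, Bool.and_eq_true]
  simp [pointChar_eq_true, hE, hF, inter_mem_ECoset hinj hE hF]

theorem isMaxChar_pointChar (hinj : ∀ s : S, Function.Injective (σ s)) (x : G) :
    IsMaxChar σ (pointChar σ x) := by
  refine ⟨isChar_pointChar hinj x, fun ω (hω : IsChar σ ω) h => h.antisymm' fun E hE => ?_⟩
  obtain ⟨g, C, hC, rfl⟩ := hω.exists_eq_smul hE
  have hx : ω (x • (C : Set G)) = true :=
    h (pointChar_eq_true.2 ⟨smul_coe_mem_ECoset hC x, mem_smul_coe_self C x⟩)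
  obtain ⟨y, hy, hy'⟩ := hω.nonempty (hω.inter hE hx)
  refine pointChar_eq_true.2 ⟨smul_coe_mem_ECoset hC g, ?_⟩
  rw [smul_coe_eq_of_mem hy, ← smul_coe_eq_of_mem hy']
  exact mem_smul_coe_self C x

/-- Any `E` outside the filter of a maximal character is disjoint from some member of it. -/
theorem IsMaxChar.exists_disjoint (hinj : ∀ s : S, Function.Injective (σ s))
    {χ : Set G → Bool} (hχ : IsMaxChar σ χ) {E : Set G} (hE : E ∈ ECoset σ)
    (hχE : χ E = false) : ∃ F, χ F = true ∧ Disjoint F E := by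
  classical
  by_contra! hF
  have hchar : ∀ F, χ F = true → F ∈ ECoset σ := fun F => hχ.1.mem_ECoset
  let ω : Set G → Bool := fun F => decide (F ∈ ECoset σ ∧ ∃ F', χ F' = true ∧ F' ∩ E ⊆ F)
  have hω : IsChar σ ω := by
    refine ⟨?_, ?_, ?_, fun F h => by simp [ω, h]⟩
    · simp only [ω, decide_eq_false_iff_not, not_and, not_exists]
      intro _ F' h h'
      exact hF F' h (Set.disjoint_iff.2 h')
    · simp only [ω, decide_eq_true_eq]
      exact ⟨univ_mem_ECoset, Set.univ, hχ.1.2.1, Set.subset_univ _⟩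
    · intro A B hA hB
      rw [Bool.eq_iff_iff]
      simp only [ω, Bool.and_eq_true, decide_eq_true_eq]
      constructor
      · rintro ⟨-, F', h, h'⟩
        exact ⟨⟨hA, F', h, h'.trans Set.inter_subset_left⟩,
          hB, F', h, h'.trans Set.inter_subset_right⟩
      · rintro ⟨⟨-, F', h, h'⟩, -, F'', k, k'⟩
        refine ⟨inter_mem_ECoset hinj hA hB, F' ∩ F'', hχ.1.inter h k, ?_⟩
        rintro x ⟨⟨hx, hx'⟩, hxE⟩
        exact ⟨h' ⟨hx, hxE⟩, k' ⟨hx', hxE⟩⟩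
  have h := hχ.2 ω hω fun F h => by
    exact decide_eq_true ⟨hchar F h, F, h, Set.inter_subset_left⟩
  have hE' : E ∈ charFilter ω := by
    exact decide_eq_true ⟨hE, Set.univ, hχ.1.2.1, Set.inter_subset_right⟩
  rw [h] at hE'
  exact Bool.false_ne_true (hχE.symm.trans hE')

theorem IsMaxChar.mem_closure_range_pointChar (hinj : ∀ s : S, Function.Injective (σ s))
    {χ : Set G → Bool} (hχ : IsMaxChar σ χ) : χ ∈ closure (Set.range (pointChar σ)) := by
  rw [mem_closure_iff_finset]
  intro J
  have hf : ∀ E : Set G, ∃ F, χ F = true ∧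
      ∀ x ∈ F, pointChar σ x E = χ E := by
    intro E
    rcases h : χ E with _ | _
    · by_cases hE : E ∈ ECoset σ
      · obtain ⟨F, hF, hd⟩ := hχ.exists_disjoint hinj hE h
        refine ⟨F, hF, fun x hx => ?_⟩
        simp [pointChar, Set.disjoint_left.1 hd hx]
      · exact ⟨Set.univ, hχ.1.2.1, fun x _ => by simp [pointChar, hE]⟩
    · exact ⟨E, h, fun x hx => pointChar_eq_true.2 ⟨hχ.1.mem_ECoset h, hx⟩⟩
  choose f hf hf' using hf
  obtain ⟨E₀, h₀, hE₀⟩ := hχ.1.exists_subset_finset J f fun E _ => hf E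
  obtain ⟨x, hx⟩ := hχ.1.nonempty h₀
  exact ⟨_, ⟨x, rfl⟩, fun E hE => hf' E x (hE₀ E hE hx)⟩

theorem boundary_eq (hinj : ∀ s : S, Function.Injective (σ s)) :
    Boundary σ = {χ | IsChar σ χ} ∩ closure (Set.range (pointChar σ)) := by
  refine congrArg _ (Set.Subset.antisymm ?_ ?_)
  · exact closure_minimal (fun χ hχ => hχ.mem_closure_range_pointChar hinj) isClosed_closure
  · exact closure_mono (Set.range_subset_iff.2 (isMaxChar_pointChar hinj))

theorem finite_cosets {C D : Subgroup G} (h : D.relIndex C ≠ 0) (g : G) :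
    {E : Set G | ∃ x ∈ g • (C : Set G), E = x • (D : Set G)}.Finite := by
  have : Finite (C ⧸ D.subgroupOf C) := Nat.finite_of_card_ne_zero h
  refine (Set.finite_range fun q : C ⧸ D.subgroupOf C => (g * (q.out : G)) • (D : Set G)).subset ?_
  rintro _ ⟨x, hx, rfl⟩
  have hx' : g⁻¹ * x ∈ C := (mem_leftCoset_iff g).1 hx
  refine ⟨QuotientGroup.mk ⟨g⁻¹ * x, hx'⟩, ?_⟩
  have h' := QuotientGroup.mk_out_eq_mul (D.subgroupOf C) ⟨g⁻¹ * x, hx'⟩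
  obtain ⟨d, hd⟩ := h'
  have hd' : (d : G) ∈ D := d.2
  simp only [leftCoset_eq_iff, hd]
  simpa [mul_assoc] using hd'

theorem finHerFilter_FilC (hinj : ∀ s : S, Function.Injective (σ s)) {χ : Set G → Bool}
    (hχ : χ ∈ Boundary σ) : FinHerFilter σ (FilC σ χ) := by
  rw [boundary_eq hinj] at hχ
  obtain ⟨hχ, hcl⟩ := hχ
  have hχ : IsChar σ χ := hχ
  refine ⟨fun C h => h.1, ⟨.top, 1, by simpa using hχ.2.1⟩, ?_, ?_, ?_⟩
  · rintro C ⟨hC, g, hg⟩ D ⟨hD, h, hh⟩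
    have hi := hχ.inter hg hh
    obtain ⟨x, hx, hx'⟩ := hχ.nonempty hi
    rw [smul_coe_eq_of_mem hx, smul_coe_eq_of_mem hx', ← Set.smul_set_inter,
      ← Subgroup.coe_inf] at hi
    exact ⟨hC.inf hinj hD, x, hi⟩
  · rintro C ⟨hC, g, hg⟩ D hD hCD
    exact ⟨hD, g, hχ.mono hg (smul_coe_mem_ECoset hD g) (Set.smul_set_mono hCD)⟩
  · rintro C ⟨hC, g, hg⟩ D hD hDC hfin
    have hF := finite_cosets hfin g
    classical
    obtain ⟨_, ⟨x, rfl⟩, hx⟩ := mem_closure_iff_finset.1 hcl (insert (g • (C : Set G)) hF.toFinset)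
    have hxC : x ∈ g • (C : Set G) := by
      have := hx _ (Finset.mem_insert_self _ _)
      rw [hg] at this
      exact (pointChar_eq_true.1 this).2
    refine ⟨hD, x, ?_⟩
    rw [← hx _ (Finset.mem_insert_of_mem (by simpa using ⟨x, hxC, rfl⟩))]
    exact pointChar_eq_true.2 ⟨smul_coe_mem_ECoset hD x, mem_smul_coe_self D x⟩

/-! ### The partial action on characters -/

theorem charAct_apply {φ : Set (G × G)} {χ : Set G → Bool} {E : Set G} (hE : E ∈ ECoset σ) :
    charAct σ φ χ E = χ (preimRel φ E) := if_pos hE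

theorem charAct_of_notMem {φ : Set (G × G)} {χ : Set G → Bool} {E : Set G} (hE : E ∉ ECoset σ) :
    charAct σ φ χ E = false := if_neg hE

theorem charAct_mul {χ : Set G → Bool} (hχ : IsChar σ χ) (t : G) (E : Set G) :
    charAct σ (grph fun h : G => t * h) χ E = χ (t⁻¹ • E) := by
  by_cases hE : E ∈ ECoset σ
  · rw [charAct_apply hE, preimRel_grph_mul]
  · rw [charAct_of_notMem hE, hχ.2.2.2 _ (mt smul_mem_ECoset_iff.1 hE)]

theorem charAct_rcomp {φ ψ : Set (G × G)} (hφ : memI σ φ) (χ : Set G → Bool) :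
    charAct σ (rcomp φ ψ) χ = charAct σ φ (charAct σ ψ χ) := by
  ext E
  by_cases hE : E ∈ ECoset σ
  · rw [charAct_apply hE, charAct_apply hE, charAct_apply (preimRel_mem_ECoset hφ hE),
      preimRel_rcomp]
  · rw [charAct_of_notMem hE, charAct_of_notMem hE]

theorem isChar_charAct (hinj : ∀ s : S, Function.Injective (σ s)) {φ : Set (G × G)}
    (hφ : memI σ φ) {χ : Set G → Bool} (hχ : IsChar σ χ) (hdom : χ (rdom φ) = true) :
    IsChar σ (charAct σ φ χ) := by
  refine ⟨?_, ?_, fun E F hE hF => ?_, fun E hE => charAct_of_notMem hE⟩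
  · rw [charAct_apply empty_mem_ECoset, show preimRel φ ∅ = ∅ by simp [preimRel], hχ.1]
  · rw [charAct_apply univ_mem_ECoset, preimRel_univ, hdom]
  · rw [charAct_apply (inter_mem_ECoset hinj hE hF), charAct_apply hE, charAct_apply hF,
      preimRel_inter hinj hφ]
    exact hχ.2.2.1 _ _ (preimRel_mem_ECoset hφ hE) (preimRel_mem_ECoset hφ hF)

theorem charAct_pointChar (hinj : ∀ s : S, Function.Injective (σ s)) {φ : Set (G × G)}
    (hφ : memI σ φ) {x y : G} (hxy : (x, y) ∈ φ) :
    charAct σ φ (pointChar σ x) = pointChar σ y := by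
  ext E
  by_cases hE : E ∈ ECoset σ
  · rw [charAct_apply hE, Bool.eq_iff_iff, pointChar_eq_true, pointChar_eq_true]
    refine ⟨fun ⟨_, z, hz, h⟩ => ⟨hE, memI_functional hinj hφ hxy h ▸ hz⟩,
      fun ⟨_, h⟩ => ⟨preimRel_mem_ECoset hφ hE, y, h, hxy⟩⟩
  · rw [charAct_of_notMem hE, (isChar_pointChar hinj y).2.2.2 E hE]

theorem charAct_mem_boundary (hinj : ∀ s : S, Function.Injective (σ s)) {φ : Set (G × G)}
    (hφ : memI σ φ) {χ : Set G → Bool} (hχ : χ ∈ Boundary σ) (hdom : χ (rdom φ) = true) :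
    charAct σ φ χ ∈ Boundary σ := by
  classical
  rw [boundary_eq hinj] at hχ ⊢
  refine ⟨isChar_charAct hinj hφ hχ.1 hdom, mem_closure_iff_finset.2 fun J => ?_⟩
  obtain ⟨_, ⟨x, rfl⟩, hx⟩ :=
    mem_closure_iff_finset.1 hχ.2 (insert (rdom φ) (J.image (preimRel φ)))
  have hxd := hx _ (Finset.mem_insert_self _ _)
  rw [hdom] at hxd
  obtain ⟨-, y, hy⟩ := pointChar_eq_true.1 hxd
  refine ⟨_, ⟨y, rfl⟩, fun E hE => ?_⟩
  rw [← charAct_pointChar hinj hφ hy]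
  by_cases hE' : E ∈ ECoset σ
  · rw [charAct_apply hE', charAct_apply hE',
      hx _ (Finset.mem_insert_of_mem (Finset.mem_image_of_mem _ hE))]
  · rw [charAct_of_notMem hE', charAct_of_notMem hE']

theorem FilC_charAct_mul {χ : Set G → Bool} (hχ : IsChar σ χ) (t : G) :
    FilC σ (charAct σ (grph fun h : G => t * h) χ) = FilC σ χ := by
  ext C
  simp only [FilC, Set.mem_ofPred_eq, charAct_mul hχ, smul_smul]
  exact and_congr_right fun _ => (Group.mulLeft_bijective t⁻¹).surjective.exists (p := fun g =>
    χ (g • (C : Set G)) = true) |>.symm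

theorem isSmallestFHF_FilC_charAct (hinj : ∀ s : S, Function.Injective (σ s)) {φ : Set (G × G)}
    (hφ : memIe σ φ) {χ : Set G → Bool} (hχ : χ ∈ Boundary σ) (hdom : χ (rdom φ) = true) :
    IsSmallestFHF σ (filterActGens σ φ (FilC σ χ)) (FilC σ (charAct σ φ χ)) := by
  have hφI := memI_of_memIe hφ
  refine ⟨finHerFilter_FilC hinj (charAct_mem_boundary hinj hφI hχ hdom), ?_, ?_⟩
  · rintro B ⟨D, ⟨hD, h, hh⟩, hsub, hB⟩
    obtain ⟨x, hxD, y, hxy⟩ := hχ.1.nonempty (hχ.1.inter hh hdom)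
    have hBc : IsConstructible σ B := by
      obtain ⟨B', hB', h'⟩ := exists_preimRel_eq (.inv _ hφ) hD
      obtain rfl : B = B' := SetLike.coe_injective (hB.trans h'.symm)
      exact hB'
    refine ⟨hBc, y, ?_⟩
    rw [charAct_apply (smul_coe_mem_ECoset hBc y), preimRel_smul hφ hxy]
    have hDB : preimRel φ (B : Set G) = D := by
      rw [hB]
      ext z
      constructor
      · rintro ⟨w, ⟨z', hz', h₁⟩, h₂⟩
        have : z' = z := memI_functional hinj (.inv _ hφI) (x := w) h₁ h₂
        exact this ▸ hz'
      · intro hz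
        obtain ⟨w, hw⟩ := hsub hz
        exact ⟨w, ⟨z, hz, hw⟩, hw⟩
    rwa [hDB, ← smul_coe_eq_of_mem hxD]
  · rintro 𝔊 h𝔊 hsub C ⟨hC, g, hg⟩
    rw [charAct_apply (smul_coe_mem_ECoset hC g)] at hg
    obtain ⟨x, y, hy, hxy⟩ := hχ.1.nonempty hg
    obtain ⟨D, hD, hDC⟩ := exists_preimRel_eq hφ hC
    rw [smul_coe_eq_of_mem hy, preimRel_smul hφ hxy, ← hDC] at hg
    obtain ⟨B, hB, hBD⟩ := exists_preimRel_eq (.inv _ hφ) hD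
    have hBmem : B ∈ 𝔊 := hsub ⟨D, ⟨hD, x, hg⟩, fun z hz => by
      rw [hDC] at hz
      exact hz.imp fun w hw => hw.2, hBD⟩
    refine h𝔊.2.2.2.1 B hBmem C hC fun z hz => ?_
    rw [← SetLike.mem_coe, hBD] at hz
    obtain ⟨w, hw, hwz⟩ := hz
    rw [hDC] at hw
    obtain ⟨v, hv, h⟩ := hw
    obtain rfl : v = z := memI_functional hinj hφI h hwz
    exact hv

/-! ### Approximation by translates -/

/-- A form of B. H. Neumann's lemma for translates of subgroups of infinite relative index. -/
theorem exists_forall_mul_mul_notMem {ι : Type*} (J : Finset ι) (C : Subgroup G)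
    (H : ι → Subgroup G) (b : ι → G) (c : ι → G) (hc : ∀ i ∈ J, c i ∈ C)
    (hH : ∀ i ∈ J, (H i).relIndex C = 0) : ∃ x ∈ C, ∀ i ∈ J, b i * x * c i ∉ H i := by
  classical
  by_contra! hcov
  let c' : ι → C := fun i => if h : c i ∈ C then ⟨c i, h⟩ else 1
  let L : ι → Subgroup C := fun i =>
    ((H i).subgroupOf C).map (MulAut.conj (c' i) : C ≃* C)
  let a : ι → C := fun i => if h : ∃ x : C, b i * x * c i ∈ H i then h.choose else 1
  have hcover : ⋃ i ∈ J, a i • (L i : Set C) = Set.univ := by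
    refine Set.eq_univ_of_forall fun x => ?_
    obtain ⟨i, hi, hx⟩ := hcov x x.2
    have hex : ∃ x : C, b i * x * c i ∈ H i := ⟨x, hx⟩
    have ha : b i * (a i : G) * c i ∈ H i := by
      simp only [a, dif_pos hex]
      exact hex.choose_spec
    refine Set.mem_biUnion hi ((mem_leftCoset_iff _).2 ?_)
    refine Subgroup.mem_map.2 ⟨(c' i)⁻¹ * ((a i)⁻¹ * x) * c' i, ?_, ?_⟩
    · have hc' : (c' i : G) = c i := by simp [c', hc i hi]
      rw [Subgroup.mem_subgroupOf]
      have := (H i).mul_mem ((H i).inv_mem ha) hx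
      convert this using 1
      push_cast
      rw [hc']
      group
    · simp [MulAut.conj_apply, mul_assoc]
  obtain ⟨k, hk, hfin⟩ := Subgroup.exists_finiteIndex_of_leftCoset_cover hcover
  refine hfin.index_ne_zero ?_
  rw [Subgroup.index_map_equiv]
  exact hH k hk

theorem FinHerFilter.relIndex_eq_zero (hinj : ∀ s : S, Function.Injective (σ s))
    {𝔉 : Set (Subgroup G)} (h𝔉 : FinHerFilter σ 𝔉) {C H : Subgroup G} (hC : C ∈ 𝔉)
    (hH : IsConstructible σ H) (hH𝔉 : H ∉ 𝔉) : H.relIndex C = 0 := by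
  by_contra h
  have hi := hH.inf hinj (h𝔉.1 C hC)
  refine hH𝔉 (h𝔉.2.2.2.1 (H ⊓ C) ?_ H hH inf_le_left)
  exact h𝔉.2.2.2.2 C hC _ hi inf_le_right (by rwa [Subgroup.inf_relIndex_right])

theorem mem_closure_of_forall_mem_FilC (hinj : ∀ s : S, Function.Injective (σ s))
    {𝔛 : Set (Set G → Bool)} (hchar : ∀ ω ∈ 𝔛, IsChar σ ω)
    (htrans : ∀ t : G, ∀ ω ∈ 𝔛, charAct σ (grph fun h : G => t * h) ω ∈ 𝔛)
    {χ : Set G → Bool} (hχ : IsChar σ χ) (hfil : FinHerFilter σ (FilC σ χ))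
    (hsub : ∀ C ∈ FilC σ χ, ∃ ω ∈ 𝔛, C ∈ FilC σ ω) : χ ∈ closure 𝔛 := by
  classical
  rw [mem_closure_iff_finset]
  intro J
  have hf : ∀ E : Set G, ∃ F, χ F = true ∧ (χ E = true → F ⊆ E) ∧
      (χ E = false → E ∈ ECoset σ → Disjoint F E ∨
        ∃ (a : G) (H : Subgroup G), IsConstructible σ H ∧ H ∉ FilC σ χ ∧ E = a • (H : Set G)) := by
    intro E
    rcases h : χ E with _ | _
    · by_cases hE : E ∈ ECoset σ
      · rcases id hE with rfl | ⟨a, H, hH, rfl⟩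
        · exact ⟨Set.univ, hχ.2.1, by simp, by simp⟩
        · by_cases hHχ : H ∈ FilC σ χ
          · obtain ⟨-, g, hg⟩ := hHχ
            refine ⟨_, hg, by simp, fun _ _ => Or.inl (Set.disjoint_left.2 fun x hx hx' => ?_)⟩
            rw [smul_coe_eq_of_mem hx, ← smul_coe_eq_of_mem hx', h] at hg
            exact Bool.false_ne_true hg
          · exact ⟨Set.univ, hχ.2.1, by simp, fun _ _ => Or.inr ⟨a, H, hH, hHχ, rfl⟩⟩
      · exact ⟨Set.univ, hχ.2.1, by simp, fun _ h' => absurd h' hE⟩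
    · exact ⟨E, h, fun _ => subset_rfl, by simp⟩
  choose f hf hpos hneg using hf
  obtain ⟨E₀, h₀, hE₀⟩ := hχ.exists_subset_finset J f fun E _ => hf E
  obtain ⟨g, C, hC, rfl⟩ := hχ.exists_eq_smul h₀
  obtain ⟨ω, hω, -, k, hk⟩ := hsub C ⟨hC, g, h₀⟩
  obtain ⟨ω', hω', hg⟩ : ∃ ω' ∈ 𝔛, ω' (g • (C : Set G)) = true := by
    refine ⟨_, htrans (g * k⁻¹) ω hω, ?_⟩
    rw [charAct_mul (hchar ω hω), smul_smul]
    simpa using hk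
  have hω'c := hchar ω' hω'
  let P : Set G → G → G → Subgroup G → Prop := fun E a c H =>
    IsConstructible σ H ∧ H ∉ FilC σ χ ∧ E = a • (H : Set G) ∧ c ∈ C ∧
      ω' ((g * c) • (H : Set G)) = true
  let Q : Set G → Prop := fun E => ∃ a c H, P E a c H
  have hQ : ∀ E, ∃ a c H, Q E → P E a c H := by
    intro E
    by_cases h : Q E
    · obtain ⟨a, c, H, h⟩ := h
      exact ⟨a, c, H, fun _ => h⟩
    · exact ⟨1, 1, ⊤, fun h' => absurd h' h⟩
  choose a c H hP using hQ
  obtain ⟨x, hxC, hx⟩ := exists_forall_mul_mul_notMem (J.filter Q) C H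
    (fun E => (a E)⁻¹ * g) c (fun E hE => (hP E (Finset.mem_filter.1 hE).2).2.2.2.1)
    (fun E hE => by
      have h := hP E (Finset.mem_filter.1 hE).2
      exact hfil.relIndex_eq_zero hinj ⟨hC, g, h₀⟩ h.1 h.2.1)
  refine ⟨_, htrans (g * x * g⁻¹) ω' hω', fun E hE => ?_⟩
  have hgC : (g * x * g⁻¹)⁻¹ • g • (C : Set G) = g • (C : Set G) := by
    rw [smul_smul, leftCoset_eq_iff]
    simpa [mul_assoc] using hxC
  have hω₂ := charAct_mul hω'c (g * x * g⁻¹)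
  have hω₂c : IsChar σ (charAct σ (grph fun h : G => (g * x * g⁻¹) * h) ω') :=
    hchar _ (htrans _ ω' hω')
  have hω₂g := hω₂ (g • (C : Set G))
  rw [hgC, hg] at hω₂g
  rcases hχE : χ E with _ | _
  · by_cases hE' : E ∈ ECoset σ
    · by_contra hne
      rw [Bool.not_eq_false] at hne
      rcases hneg E hχE hE' with hd | ⟨a', H', hH', hH'χ, hEa⟩
      · obtain ⟨y, hy, hy'⟩ := hω₂c.nonempty (hω₂c.inter hω₂g hne)
        exact Set.disjoint_left.1 hd (hE₀ E hE hy) hy'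
      · rw [hω₂] at hne
        have hQE : Q E := by
          obtain ⟨y, hy, hy'⟩ := hω'c.nonempty (hω'c.inter hg hne)
          refine ⟨a', g⁻¹ * y, H', hH', hH'χ, hEa, (mem_leftCoset_iff g).1 hy, ?_⟩
          rw [hEa, smul_smul] at hy' hne
          rw [mul_inv_cancel_left, ← smul_coe_eq_of_mem hy', hne]
        obtain ⟨-, -, hEa, -, hgc⟩ := hP E hQE
        refine hx E (Finset.mem_filter.2 ⟨hE, hQE⟩) ?_
        rw [hEa, smul_smul] at hne
        obtain ⟨y, hy, hy'⟩ := hω'c.nonempty (hω'c.inter hne hgc)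
        have h := (smul_coe_eq_of_mem hy).trans (smul_coe_eq_of_mem hy').symm
        rw [leftCoset_eq_iff] at h
        convert h using 1
        group
    · exact hω₂c.2.2.2 E hE'
  · exact hω₂c.mono hω₂g (hχ.mem_ECoset hχE) ((hE₀ E hE).trans (hpos E hχE))

theorem mem_boundary_of_finHerFilter (hinj : ∀ s : S, Function.Injective (σ s))
    {χ : Set G → Bool} (hχ : IsChar σ χ) (hfil : FinHerFilter σ (FilC σ χ)) :
    χ ∈ Boundary σ := by
  rw [boundary_eq hinj]
  refine ⟨hχ, mem_closure_of_forall_mem_FilC hinj ?_ ?_ hχ hfil ?_⟩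
  · rintro _ ⟨x, rfl⟩
    exact isChar_pointChar hinj x
  · rintro t _ ⟨x, rfl⟩
    exact ⟨t * x, (charAct_pointChar hinj (memI_mul t) (y := t * x) rfl).symm⟩
  · intro C hC
    exact ⟨_, ⟨1, rfl⟩, hC.1, 1,
      pointChar_eq_true.2 ⟨smul_coe_mem_ECoset hC.1 1, mem_smul_coe_self C 1⟩⟩

open Classical in
/-- The character whose filter consists of the subgroups in `𝔉`. -/
noncomputable def subgroupChar (𝔉 : Set (Subgroup G)) : Set G → Bool :=
  fun E => decide (∃ C ∈ 𝔉, E = (C : Set G))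

theorem subgroupChar_eq_true {𝔉 : Set (Subgroup G)} {E : Set G} :
    subgroupChar 𝔉 E = true ↔ ∃ C ∈ 𝔉, E = (C : Set G) := by simp [subgroupChar]

theorem isChar_subgroupChar {𝔉 : Set (Subgroup G)} (h𝔉 : FinHerFilter σ 𝔉) :
    IsChar σ (subgroupChar 𝔉) := by
  refine ⟨?_, subgroupChar_eq_true.2 ⟨⊤, h𝔉.2.1, by simp⟩, fun E F hE hF => ?_, fun E hE => ?_⟩
  · rw [← Bool.not_eq_true, subgroupChar_eq_true]
    rintro ⟨C, -, h⟩
    exact (OneMemClass.coe_nonempty C).ne_empty h.symm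
  · have aux : ∀ {A : Set G} {B : Subgroup G}, A ∈ ECoset σ → B ∈ 𝔉 → (B : Set G) ⊆ A →
        ∃ C ∈ 𝔉, A = (C : Set G) := by
      intro A B hA hB hBA
      obtain ⟨C, hC, rfl⟩ := eq_smul_of_mem_ECoset hA (hBA B.one_mem)
      rw [one_smul] at hBA ⊢
      exact ⟨C, h𝔉.2.2.2.1 B hB C hC hBA, rfl⟩
    rw [Bool.eq_iff_iff, Bool.and_eq_true]
    simp only [subgroupChar_eq_true]
    constructor
    · rintro ⟨C, hC, h⟩
      exact ⟨aux hE hC (h ▸ Set.inter_subset_left), aux hF hC (h ▸ Set.inter_subset_right)⟩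
    · rintro ⟨⟨C, hC, rfl⟩, D, hD, rfl⟩
      exact ⟨C ⊓ D, h𝔉.2.2.1 C hC D hD, rfl⟩
  · rw [← Bool.not_eq_true, subgroupChar_eq_true]
    rintro ⟨C, hC, rfl⟩
    exact hE (coe_mem_ECoset (h𝔉.1 C hC))

theorem FilC_subgroupChar {𝔉 : Set (Subgroup G)} (h𝔉 : FinHerFilter σ 𝔉) :
    FilC σ (subgroupChar 𝔉) = 𝔉 := by
  ext C
  constructor
  · rintro ⟨hC, g, hg⟩
    obtain ⟨D, hD, h⟩ := subgroupChar_eq_true.1 hg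
    have h1 : (1 : G) ∈ g • (C : Set G) := h ▸ D.one_mem
    rw [smul_coe_eq_of_mem h1, one_smul] at h
    rwa [SetLike.coe_injective h]
  · exact fun hC => ⟨h𝔉.1 C hC, 1, subgroupChar_eq_true.2 ⟨C, hC, by simp⟩⟩

theorem subgroupChar_mem_boundary (hinj : ∀ s : S, Function.Injective (σ s))
    {𝔉 : Set (Subgroup G)} (h𝔉 : FinHerFilter σ 𝔉) : subgroupChar 𝔉 ∈ Boundary σ :=
  mem_boundary_of_finHerFilter hinj (isChar_subgroupChar h𝔉)
    ((FilC_subgroupChar h𝔉).symm ▸ h𝔉)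

/-! ### Invariance -/

theorem IsSmallestFHF.unique {A 𝔊 𝔊' : Set (Subgroup G)} (h : IsSmallestFHF σ A 𝔊)
    (h' : IsSmallestFHF σ A 𝔊') : 𝔊 = 𝔊' :=
  (h.2.2 𝔊' h'.1 h'.2.1).antisymm (h'.2.2 𝔊 h.1 h.2.1)

theorem ieInvariant_image_FilC (hinj : ∀ s : S, Function.Injective (σ s))
    {𝔛 : Set (Set G → Bool)} (hX : 𝔛 ⊆ Boundary σ) (hinv : IsInvariantSet σ 𝔛) :
    IeInvariant σ (FilC σ '' 𝔛) := by
  rintro _ ⟨ω, hω, rfl⟩ φ hφ ⟨C, ⟨hC, g, hg⟩, hCφ⟩ 𝔊 h𝔊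
  have hωc := (hX hω).1
  have hω₂ : charAct σ (grph fun h : G => g⁻¹ * h) ω ∈ 𝔛 :=
    hinv _ (memI_mul g⁻¹) ω hω (by simpa [rdom, grph] using hωc.2.1)
  have hdom : charAct σ (grph fun h : G => g⁻¹ * h) ω (rdom φ) = true := by
    refine (hX hω₂).1.mono (E := C) ?_ (rdom_mem_ECoset (memI_of_memIe hφ)) hCφ
    rw [charAct_mul hωc, inv_inv, hg]
  refine ⟨_, hinv φ (memI_of_memIe hφ) _ hω₂ hdom, ?_⟩
  refine IsSmallestFHF.unique (isSmallestFHF_FilC_charAct hinj hφ (hX hω₂) hdom) ?_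
  rwa [FilC_charAct_mul hωc]

theorem isInvariantSet_of_ieInvariant (hinj : ∀ s : S, Function.Injective (σ s))
    {𝔽 : Set (Set (Subgroup G))} (hinv : IeInvariant σ 𝔽) :
    IsInvariantSet σ {χ ∈ Boundary σ | FilC σ χ ∈ 𝔽} := by
  have hIe : ∀ φ, memIe σ φ → ∀ χ ∈ {χ ∈ Boundary σ | FilC σ χ ∈ 𝔽}, χ (rdom φ) = true →
      charAct σ φ χ ∈ {χ ∈ Boundary σ | FilC σ χ ∈ 𝔽} := by
    rintro φ hφ χ ⟨hχ, hχ𝔽⟩ hdom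
    refine ⟨charAct_mem_boundary hinj (memI_of_memIe hφ) hχ hdom,
      hinv _ hχ𝔽 φ hφ ?_ _ (isSmallestFHF_FilC_charAct hinj hφ hχ hdom)⟩
    obtain ⟨D, hD, h⟩ := exists_preimRel_eq hφ .top
    rw [Subgroup.coe_top, preimRel_univ] at h
    exact ⟨D, ⟨hD, 1, by rwa [one_smul, h]⟩, h.le⟩
  have htrans : ∀ t : G, ∀ χ ∈ {χ ∈ Boundary σ | FilC σ χ ∈ 𝔽},
      χ (rdom (grph fun h : G => t * h)) = true →
      charAct σ (grph fun h : G => t * h) χ ∈ {χ ∈ Boundary σ | FilC σ χ ∈ 𝔽} := by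
    rintro t χ ⟨hχ, hχ𝔽⟩ hdom
    exact ⟨charAct_mem_boundary hinj (memI_mul t) hχ hdom, by rwa [FilC_charAct_mul hχ.1]⟩
  intro φ hφ
  refine (MemInvSemigroup.induction_inv (P := fun φ => ∀ χ ∈ {χ ∈ Boundary σ | FilC σ χ ∈ 𝔽},
    χ (rdom φ) = true → charAct σ φ χ ∈ {χ ∈ Boundary σ | FilC σ χ ∈ 𝔽}) ?_ ?_ hφ).1
  · rintro φ (⟨s, rfl⟩ | ⟨t, rfl⟩)
    · have hs : memIe σ (grph (σ s)) := .base _ ⟨s, rfl⟩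
      exact ⟨hIe _ hs, hIe _ (.inv _ hs)⟩
    · rw [rinv_grph_mul]
      exact ⟨htrans t, htrans t⁻¹⟩
  · intro φ ψ hφ hψ ih ih' χ hχ hdom
    rw [charAct_rcomp hφ]
    rw [← preimRel_univ, preimRel_rcomp, preimRel_univ] at hdom
    refine ih _ (ih' χ hχ ?_) ?_
    · refine hχ.1.1.mono hdom (rdom_mem_ECoset hψ) ?_
      rw [← preimRel_univ ψ]
      exact preimRel_mono ψ (Set.subset_univ _)
    · rwa [charAct_apply (rdom_mem_ECoset hφ)]

theorem mem_of_forall_mem_FilC (hinj : ∀ s : S, Function.Injective (σ s))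
    {𝔛 : Set (Set G → Bool)} (hX : 𝔛 ⊆ Boundary σ) (hcl : closure 𝔛 ∩ Boundary σ ⊆ 𝔛)
    (hinv : IsInvariantSet σ 𝔛) {χ : Set G → Bool} (hχ : χ ∈ Boundary σ)
    (hsub : ∀ C ∈ FilC σ χ, ∃ ω ∈ 𝔛, C ∈ FilC σ ω) : χ ∈ 𝔛 := by
  refine hcl ⟨mem_closure_of_forall_mem_FilC hinj (fun ω hω => (hX hω).1) (fun t ω hω => ?_) hχ.1
    (finHerFilter_FilC hinj hχ) hsub, hχ⟩
  exact hinv _ (memI_mul t) ω hω (by simpa [rdom, grph] using (hX hω).1.2.1)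

end Helpers

/-- Theorem 4.4 (thm:ClosedInvariantSubsp): `𝔛 ↦ 𝔉(𝔛) = {𝔉(χ) : χ ∈ 𝔛}` is a
one-to-one correspondence between closed `I`-invariant subsets of `∂Ê` and
`I^e`-invariant, `⊆`-closed subsets of `𝔽_𝒞`, with inverse
`𝔽 ↦ {χ ∈ ∂Ê : 𝔉(χ) ∈ 𝔽}`. -/
theorem closed_invariant_subspaces_correspondence
    {S G : Type*} [Monoid S] [Group G] [Nontrivial G]
    (σ : S →* Monoid.End G)
    (hinj : ∀ s : S, Function.Injective (σ s))
    (hfaith : Function.Injective σ)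
    (hna : ∃ s : S, Set.range (σ s : G → G) ≠ Set.univ) :
    (∀ 𝔛 : Set (Set G → Bool), 𝔛 ⊆ Boundary σ → closure 𝔛 ∩ Boundary σ ⊆ 𝔛 →
      IsInvariantSet σ 𝔛 →
      ((∀ 𝔉 ∈ FilC σ '' 𝔛, FinHerFilter σ 𝔉) ∧
        IeInvariant σ (FilC σ '' 𝔛) ∧ SubsetClosed σ (FilC σ '' 𝔛) ∧
        {χ ∈ Boundary σ | FilC σ χ ∈ FilC σ '' 𝔛} = 𝔛)) ∧
    (∀ 𝔽 : Set (Set (Subgroup G)), (∀ 𝔉 ∈ 𝔽, FinHerFilter σ 𝔉) →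
      IeInvariant σ 𝔽 → SubsetClosed σ 𝔽 →
      ({χ ∈ Boundary σ | FilC σ χ ∈ 𝔽} ⊆ Boundary σ ∧
        closure {χ ∈ Boundary σ | FilC σ χ ∈ 𝔽} ∩ Boundary σ ⊆
          {χ ∈ Boundary σ | FilC σ χ ∈ 𝔽} ∧
        IsInvariantSet σ {χ ∈ Boundary σ | FilC σ χ ∈ 𝔽} ∧
        FilC σ '' {χ ∈ Boundary σ | FilC σ χ ∈ 𝔽} = 𝔽)) := by
  refine ⟨fun 𝔛 hX hcl hinv => ⟨?_, ieInvariant_image_FilC hinj hX hinv, ?_, ?_⟩,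
    fun 𝔽 hF hinv hsub => ⟨fun χ hχ => hχ.1, ?_, isInvariantSet_of_ieInvariant hinj hinv, ?_⟩⟩
  · rintro _ ⟨χ, hχ, rfl⟩
    exact finHerFilter_FilC hinj (hX hχ)
  · intro 𝔈 h𝔈 h
    refine ⟨_, mem_of_forall_mem_FilC hinj hX hcl hinv (subgroupChar_mem_boundary hinj h𝔈) ?_,
      FilC_subgroupChar h𝔈⟩
    simpa [FilC_subgroupChar h𝔈] using h
  · refine Set.Subset.antisymm ?_ fun χ hχ => ⟨hX hχ, χ, hχ, rfl⟩
    rintro χ ⟨hχ, ω, hω, h⟩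
    exact mem_of_forall_mem_FilC hinj hX hcl hinv hχ fun C hC => ⟨ω, hω, h ▸ hC⟩
  · rintro χ ⟨hcl, hχ⟩
    refine ⟨hχ, hsub _ (finHerFilter_FilC hinj hχ) ?_⟩
    rintro C ⟨hC, g, hg⟩
    obtain ⟨ω, hω, h⟩ := mem_closure_iff_finset.1 hcl {g • (C : Set G)}
    exact ⟨_, hω.2, hC, g, by rw [h _ (Finset.mem_singleton_self _), hg]⟩
  · refine Set.Subset.antisymm ?_ fun 𝔉 h𝔉 => ?_
    · rintro _ ⟨χ, hχ, rfl⟩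
      exact hχ.2
    · have h := FilC_subgroupChar (hF 𝔉 h𝔉)
      exact ⟨_, ⟨subgroupChar_mem_boundary hinj (hF 𝔉 h𝔉), by rwa [h]⟩, h⟩
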